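/- arXiv:2302.01655 — 2 statements merged into one kernel-verified Lean document; each statement's English description precedes it below -/
import Mathlib

section
/- Let F be a finite field with q elements, let n ≥ 1, let a ∈ F^×, and for each d ≥ 1 let r_d(a) denote the number of d-th roots of a in F^×. Then the number π of monic irreducible polynomials of degree n over F with constant coefficient (-1)^n·a satisfies the exact formula π = (1/n)·∑_{d ∣ n} μ(d)·r_d(a)·(q^{n/d} − 1)/(q − 1), where μ is the Möbius function; moreover π = (q^n − 1 − ε·q^{n/2})/(n·(q − 1)) for some real number ε with 0 ≤ ε ≤ 10. -/
open Polynomial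

theorem card_norm_eq {F K : Type*} [Field F] [Fintype F] [Field K] [Fintype K]
    [DecidableEq F] [Algebra F K] {a : F} (ha : a ≠ 0) :
    (Finset.univ.filter fun x : K => Algebra.norm F x = a).card * (Fintype.card F - 1) =
      Fintype.card K - 1 := by
  classical
  have key : ∀ b ∈ Finset.univ.erase (0 : F),
      (Finset.univ.filter fun x : K => Algebra.norm F x = b).card =
        (Finset.univ.filter fun x : K => Algebra.norm F x = a).card := by
    intro b hb
    have hb0 : b ≠ 0 := Finset.ne_of_mem_erase hb
    obtain ⟨y, hy⟩ := FiniteField.norm_surjective F K (a / b)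
    have hy0 : y ≠ 0 := by
      rintro rfl
      rw [Algebra.norm_zero] at hy
      exact div_ne_zero ha hb0 hy.symm
    refine Finset.card_nbij' (fun x => x * y) (fun x => x / y) ?_ ?_ ?_ ?_
    · intro x hx
      simp_all [mul_div_cancel₀]
    · intro x hx
      have hx : Algebra.norm F x = a := by simpa using hx
      have hxy : Algebra.norm F (x / y) * Algebra.norm F y = a := by
        rw [← map_mul, div_mul_cancel₀ x hy0, hx]
      rw [hy, mul_div_assoc', div_eq_iff hb0, mul_comm a b] at hxy
      simpa using mul_right_cancel₀ ha hxy
    · intro x _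
      exact mul_div_cancel_right₀ x hy0
    · intro x _
      exact div_mul_cancel₀ x hy0
  have hmaps : Set.MapsTo (Algebra.norm F) ((Finset.univ.erase (0 : K) : Finset K) : Set K)
      ((Finset.univ.erase (0 : F) : Finset F) : Set F) := by
    intro x hx
    simp_all [Algebra.norm_eq_zero_iff]
  have h := Finset.card_eq_sum_card_fiberwise hmaps
  rw [Finset.card_erase_of_mem (Finset.mem_univ _), Finset.card_univ] at h
  rw [h, ← Finset.card_univ (α := F), ← Finset.card_erase_of_mem (Finset.mem_univ (0 : F)),
    mul_comm, ← smul_eq_mul, ← Finset.sum_const]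
  refine Finset.sum_congr rfl fun b hb => ?_
  rw [← key b hb]
  congr 1
  ext x
  have hb0 : b ≠ 0 := Finset.ne_of_mem_erase hb
  simp only [Finset.mem_filter, Finset.mem_univ, true_and, Finset.mem_erase, and_true]
  refine ⟨fun hx => ⟨?_, hx⟩, fun hx => hx.2⟩
  rintro rfl
  exact hb0 (by simpa using hx.symm)

theorem norm_eq_coeff_zero_minpoly_pow {F K : Type*} [Field F] [Field K] [Algebra F K]
    [FiniteDimensional F K] (x : K) :
    Algebra.norm F x = ((-1) ^ (minpoly F x).natDegree * (minpoly F x).coeff 0) ^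
      (Module.finrank F K / (minpoly F x).natDegree) := by
  have hx : IsIntegral F x := IsIntegral.of_finite F x
  have hdeg : Module.finrank F (IntermediateField.adjoin F {x}) = (minpoly F x).natDegree :=
    IntermediateField.adjoin.finrank hx
  have hnorm := Algebra.PowerBasis.norm_gen_eq_coeff_zero_minpoly
    (IntermediateField.adjoin.powerBasis hx)
  rw [IntermediateField.adjoin.powerBasis_gen, IntermediateField.adjoin.powerBasis_dim,
    IntermediateField.minpoly_gen] at hnorm
  rw [Algebra.norm_eq_norm_adjoin, hnorm, ← hdeg,
    ← Module.finrank_mul_finrank F (IntermediateField.adjoin F {x}) K,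
    Nat.mul_div_cancel_left _ Module.finrank_pos]

theorem filter_minpoly_eq_card {F K : Type*} [Field F] [Fintype F] [Field K] [Fintype K]
    [Algebra F K] [DecidableEq F[X]] {f : F[X]} (hf : f.Monic) (hirr : Irreducible f)
    (hdvd : f.natDegree ∣ Module.finrank F K) :
    (Finset.univ.filter fun x : K => minpoly F x = f).card = f.natDegree := by
  classical
  have := Fact.mk hirr
  have : FiniteDimensional F (AdjoinRoot f) := (AdjoinRoot.powerBasis hirr.ne_zero).finite
  have : Finite (AdjoinRoot f) := Module.finite_of_finite F
  obtain ⟨g⟩ := FiniteField.nonempty_algHom_of_finrank_dvd (F := F) (K := AdjoinRoot f) (L := K)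
    (by rwa [(AdjoinRoot.powerBasis hirr.ne_zero).finrank, AdjoinRoot.powerBasis_dim])
  have hroot : aeval (g (AdjoinRoot.root f)) f = 0 := by
    rw [aeval_algHom_apply, AdjoinRoot.aeval_eq, AdjoinRoot.mk_self, map_zero]
  have hmin := minpoly.eq_of_irreducible_of_monic hirr hroot hf
  have hsplit : (f.map (algebraMap F K)).Splits := by
    rw [hmin]
    exact Normal.splits inferInstance _
  rw [← card_rootSet_eq_natDegree (PerfectField.separable_of_irreducible hirr) hsplit,
    Fintype.card_subtype]
  congr 1
  ext x
  simp only [Finset.mem_filter, Finset.mem_univ, true_and, mem_rootSet, ne_eq, hirr.ne_zero,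
    not_false_eq_true]
  refine ⟨?_, fun hx => (minpoly.eq_of_irreducible_of_monic hirr hx hf).symm⟩
  rintro rfl
  exact minpoly.aeval F x


/-- The monic irreducible polynomials of degree `n` over `F` with constant coefficient
`(-1) ^ n * a`. -/
def irreduciblesOfNorm (F : Type*) [Field F] (n : ℕ) (a : F) : Set F[X] :=
  {f | f.Monic ∧ Irreducible f ∧ f.natDegree = n ∧ f.coeff 0 = (-1 : F) ^ n * a}

theorem ncard_pow_eq {F : Type*} [Field F] [Fintype F] [DecidableEq F] {a : F} (ha : a ≠ 0)
    {d : ℕ} (hd : d ≠ 0) :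
    {x : F | x ≠ 0 ∧ x ^ d = a}.ncard = (Finset.univ.filter fun x : F => x ^ d = a).card := by
  rw [← Set.ncard_coe_finset]
  congr 1
  ext x
  simp only [Set.mem_ofPred_eq, Finset.coe_filter, Finset.mem_univ, true_and, and_iff_right_iff_imp]
  rintro h rfl
  exact ha (by rw [← h, zero_pow hd])

theorem card_filter_minpoly_mem {F K : Type*} [Field F] [Fintype F] [Field K] [Fintype K]
    [Algebra F K] {m : ℕ} (hm : m ∣ Module.finrank F K) (b : F)
    [DecidablePred fun x : K => minpoly F x ∈ irreduciblesOfNorm F m b] :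
    (Finset.univ.filter fun x : K => minpoly F x ∈ irreduciblesOfNorm F m b).card =
      m * (irreduciblesOfNorm F m b).ncard := by
  classical
  have hcard : ∀ f ∈ irreduciblesOfNorm F m b,
      (Finset.univ.filter fun x : K => minpoly F x = f).card = m := by
    rintro f ⟨hf, hirr, hdeg, -⟩
    rw [filter_minpoly_eq_card hf hirr (hdeg ▸ hm), hdeg]
  have hm0 : 0 < m := Nat.pos_of_dvd_of_pos hm Module.finrank_pos
  have hfin : (irreduciblesOfNorm F m b).Finite := by
    refine (Set.finite_range (minpoly F : K → F[X])).subset fun f hf => ?_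
    obtain ⟨x, hx⟩ := Finset.card_pos.1 (hm0.trans_eq (hcard f hf).symm)
    exact ⟨x, (Finset.mem_filter.1 hx).2⟩
  rw [Set.ncard_eq_toFinset_card _ hfin,
    Finset.card_eq_sum_card_fiberwise (f := minpoly F) (t := hfin.toFinset) (by
      intro x hx
      simpa using hx), mul_comm, ← smul_eq_mul, ← Finset.sum_const]
  refine Finset.sum_congr rfl fun f hf => ?_
  have hf := hfin.mem_toFinset.1 hf
  rw [Finset.filter_filter]
  refine Eq.trans ?_ (hcard f hf)
  congr 1
  ext x
  simp only [Finset.mem_filter, Finset.mem_univ, true_and, and_iff_right_iff_imp]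
  rintro rfl
  exact hf

theorem sum_mul_ncard_irreduciblesOfNorm {F : Type*} [Field F] [Fintype F] [DecidableEq F]
    {n : ℕ} (hn : n ≠ 0) {a : F} (ha : a ≠ 0) :
    (∑ d ∈ n.divisors, ∑ b with b ^ d = a, n / d * (irreduciblesOfNorm F (n / d) b).ncard) *
      (Fintype.card F - 1) = Fintype.card F ^ n - 1 := by
  classical
  obtain ⟨p, hp⟩ := CharP.exists F
  have : Fact p.Prime := ⟨CharP.char_is_prime F p⟩
  have : NeZero n := ⟨hn⟩
  let K := FiniteField.Extension F p n
  have : Fintype K := Fintype.ofFinite K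
  have hrank : Module.finrank F K = n := FiniteField.finrank_extension F p n
  have hK : Fintype.card K = Fintype.card F ^ n := by
    rw [Module.card_eq_pow_finrank (K := F), hrank]
  rw [← hK, ← card_norm_eq (K := K) ha]
  congr 1
  have hdeg : ∀ x : K, (minpoly F x).natDegree ∣ n := fun x =>
    (minpoly.degree_dvd (IsIntegral.of_finite F x)).trans hrank.dvd
  let φ : K → Σ _ : ℕ, F := fun x => ⟨n / (minpoly F x).natDegree,
    (-1) ^ (minpoly F x).natDegree * (minpoly F x).coeff 0⟩
  have hφ : Set.MapsTo φ (Finset.univ.filter fun x : K => Algebra.norm F x = a : Finset K)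
      (n.divisors.sigma fun d => Finset.univ.filter fun b : F => b ^ d = a : Finset _) := by
    intro x hx
    have hx : Algebra.norm F x = a := by simpa using hx
    rw [norm_eq_coeff_zero_minpoly_pow, hrank] at hx
    simp [φ, hn, Nat.div_dvd_of_dvd (hdeg x), hx]
  rw [Finset.card_eq_sum_card_fiberwise hφ, Finset.sum_sigma]
  refine Finset.sum_congr rfl fun d hd => Finset.sum_congr rfl fun b hb => ?_
  have hdn := Nat.dvd_of_mem_divisors hd
  have hb : b ^ d = a := by simpa using hb
  rw [← card_filter_minpoly_mem (K := K) (by rw [hrank]; exact Nat.div_dvd_of_dvd hdn),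
    Finset.filter_filter]
  congr 1
  ext x
  have hx : IsIntegral F x := IsIntegral.of_finite F x
  have hsign : ((-1 : F) ^ (minpoly F x).natDegree) * (-1) ^ (minpoly F x).natDegree = 1 := by
    rw [← mul_pow]; simp
  rw [Finset.mem_filter, Finset.mem_filter]
  simp only [Finset.mem_univ, true_and, irreduciblesOfNorm, Set.mem_ofPred_eq,
    φ, Sigma.mk.injEq, heq_eq_eq]
  constructor
  · rintro ⟨-, -, h1, h2⟩
    rw [norm_eq_coeff_zero_minpoly_pow, hrank, h1, Nat.div_div_self hdn hn]
    rw [h1] at hsign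
    rw [h2, ← mul_assoc, hsign, one_mul]
    exact ⟨hb, rfl, rfl⟩
  · rintro ⟨-, h1, h2⟩
    have h3 : (minpoly F x).natDegree = n / d := by
      rw [← h1, Nat.div_div_self (hdeg x) hn]
    refine ⟨minpoly.monic hx, minpoly.irreducible hx, h3, ?_⟩
    rw [← h2, h3, ← mul_assoc, ← h3, hsign, one_mul]

theorem sum_divisors_sum_divisors_div {M : Type*} [AddCommMonoid M] {n : ℕ} (f : ℕ → ℕ → M) :
    ∑ d ∈ n.divisors, ∑ e ∈ (n / d).divisors, f d (d * e) =
      ∑ m ∈ n.divisors, ∑ d ∈ m.divisors, f d m := by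
  rcases eq_or_ne n 0 with rfl | hn
  · simp
  rw [Finset.sum_sigma', Finset.sum_sigma']
  refine Finset.sum_bij' (fun x _ => ⟨x.1 * x.2, x.1⟩) (fun x _ => ⟨x.2, x.1 / x.2⟩) ?_ ?_ ?_ ?_ ?_
  · rintro ⟨d, e⟩ h
    simp only [Finset.mem_sigma, Nat.mem_divisors] at h ⊢
    obtain ⟨⟨⟨k, rfl⟩, -⟩, h2, h3⟩ := h
    have hd : 0 < d := Nat.pos_of_ne_zero (left_ne_zero_of_mul hn)
    rw [Nat.mul_div_cancel_left _ hd] at h2 h3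
    exact ⟨⟨mul_dvd_mul_left d h2, hn⟩, dvd_mul_right _ _,
      mul_ne_zero hd.ne' (ne_zero_of_dvd_ne_zero h3 h2)⟩
  · rintro ⟨m, d⟩ h
    simp only [Finset.mem_sigma, Nat.mem_divisors] at h ⊢
    obtain ⟨⟨h1, -⟩, h2, h3⟩ := h
    have hd := h2.trans h1
    exact ⟨⟨hd, hn⟩, Nat.div_dvd_div h2 h1,
      (Nat.div_pos (Nat.le_of_dvd (Nat.pos_of_ne_zero hn) hd)
        (Nat.pos_of_dvd_of_pos hd (Nat.pos_of_ne_zero hn))).ne'⟩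
  · rintro ⟨d, e⟩ h
    simp only [Finset.mem_sigma, Nat.mem_divisors] at h
    have hd : 0 < d := Nat.pos_of_dvd_of_pos h.1.1 (Nat.pos_of_ne_zero hn)
    simp [Nat.mul_div_cancel_left _ hd]
  · rintro ⟨m, d⟩ h
    simp only [Finset.mem_sigma, Nat.mem_divisors] at h
    simp [Nat.mul_div_cancel' h.2.1]
  · rintro ⟨d, e⟩ _
    rfl

theorem sum_moebius_mul_card_pow_eq {F R : Type*} [Field F] [Fintype F] [DecidableEq F] [CommRing R]
    {P : ℕ → F → R} {T : ℕ → R}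
    (hP : ∀ n ≠ 0, ∀ a ≠ 0, ∑ d ∈ n.divisors, ∑ b with b ^ d = a, P (n / d) b = T n)
    {n : ℕ} (hn : n ≠ 0) {a : F} (ha : a ≠ 0) :
    ∑ d ∈ n.divisors, (ArithmeticFunction.moebius d : R) *
      ((Finset.univ.filter fun x : F => x ^ d = a).card : R) * T (n / d) = P n a := by
  have hmoeb : ∀ m : ℕ, ∑ d ∈ m.divisors, (ArithmeticFunction.moebius d : R) =
      if m = 1 then 1 else 0 := fun m => by
    rw [← ArithmeticFunction.one_apply, ← ArithmeticFunction.coe_moebius_mul_coe_zeta,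
      ArithmeticFunction.coe_mul_zeta_apply]
    rfl
  have hterm : ∀ d ∈ n.divisors, (ArithmeticFunction.moebius d : R) *
      ((Finset.univ.filter fun x : F => x ^ d = a).card : R) * T (n / d) =
      ∑ e ∈ (n / d).divisors, (ArithmeticFunction.moebius d : R) *
        ∑ c with c ^ (d * e) = a, P (n / (d * e)) c := by
    intro d hd
    have hdn := Nat.dvd_of_mem_divisors hd
    have hd0 : d ≠ 0 := ne_zero_of_dvd_ne_zero hn hdn
    have hnd : n / d ≠ 0 :=
      (Nat.div_pos (Nat.le_of_dvd (Nat.pos_of_ne_zero hn) hdn) (Nat.pos_of_ne_zero hd0)).ne'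
    rw [mul_assoc, ← nsmul_eq_mul, ← Finset.sum_const, ← Finset.mul_sum]
    congr 1
    calc ∑ b with b ^ d = a, T (n / d)
        = ∑ b with b ^ d = a, ∑ e ∈ (n / d).divisors, ∑ c with c ^ e = b, P (n / d / e) c := by
          refine Finset.sum_congr rfl fun b hb => (hP _ hnd b ?_).symm
          rintro rfl
          exact ha (by simpa [hd0] using (Finset.mem_filter.1 hb).2.symm)
      _ = _ := by
          rw [Finset.sum_comm]
          refine Finset.sum_congr rfl fun e _ => ?_
          rw [← Finset.sum_fiberwise_of_maps_to (g := fun c => c ^ e)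
            (s := Finset.univ.filter fun c : F => c ^ (d * e) = a)
            (t := Finset.univ.filter fun b : F => b ^ d = a)
            (by simp [← pow_mul, mul_comm e d])]
          refine Finset.sum_congr rfl fun b hb => ?_
          have hb : b ^ d = a := by simpa using hb
          rw [Nat.div_div_eq_div_mul, Finset.filter_filter]
          refine Finset.sum_congr ?_ fun _ _ => rfl
          ext c
          simp only [Finset.mem_filter, Finset.mem_univ, true_and, iff_and_self]
          rintro rfl
          rw [mul_comm, pow_mul, hb]
  rw [Finset.sum_congr rfl hterm, sum_divisors_sum_divisors_div fun d m =>
    (ArithmeticFunction.moebius d : R) * ∑ c with c ^ m = a, P (n / m) c]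
  simp_rw [← Finset.sum_mul, hmoeb, ite_mul, one_mul, zero_mul]
  rw [Finset.sum_ite_eq' , if_pos (Nat.one_mem_divisors.2 hn)]
  simp [Finset.sum_filter]

theorem ncard_irreduciblesOfNorm_eq {F : Type*} [Field F] [Fintype F] {n : ℕ} (hn : n ≠ 0)
    {a : F} (ha : a ≠ 0) :
    (n : ℝ) * (irreduciblesOfNorm F n a).ncard =
      ∑ d ∈ n.divisors, (ArithmeticFunction.moebius d : ℝ) *
        ({x : F | x ≠ 0 ∧ x ^ d = a}.ncard : ℝ) *
          (((Fintype.card F : ℝ) ^ (n / d) - 1) / ((Fintype.card F : ℝ) - 1)) := by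
  classical
  have hq : (1 : ℝ) < Fintype.card F := by exact_mod_cast Fintype.one_lt_card
  have hT : ∀ n ≠ 0, ∀ a : F, a ≠ 0 →
      ∑ d ∈ n.divisors, ∑ b with b ^ d = a,
        ((n / d * (irreduciblesOfNorm F (n / d) b).ncard : ℕ) : ℝ) =
          ((Fintype.card F : ℝ) ^ n - 1) / ((Fintype.card F : ℝ) - 1) := by
    intro n hn a ha
    rw [eq_div_iff (sub_pos.2 hq).ne']
    have h := congrArg (Nat.cast : ℕ → ℝ) (sum_mul_ncard_irreduciblesOfNorm hn ha)
    rw [Nat.cast_mul, Nat.cast_sub Fintype.card_pos,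
      Nat.cast_sub (Nat.one_le_pow _ _ Fintype.card_pos)] at h
    simpa using h
  have h := sum_moebius_mul_card_pow_eq
    (P := fun n b => ((n * (irreduciblesOfNorm F n b).ncard : ℕ) : ℝ)) hT hn ha
  rw [← Nat.cast_mul, ← h]
  refine Finset.sum_congr rfl fun d hd => ?_
  rw [ncard_pow_eq ha (Nat.pos_of_mem_divisors hd).ne']

theorem mul_ncard_irreduciblesOfNorm_le {F : Type*} [Field F] [Fintype F] {n : ℕ} (hn : n ≠ 0)
    {a : F} (ha : a ≠ 0) :
    (n : ℝ) * (irreduciblesOfNorm F n a).ncard * ((Fintype.card F : ℝ) - 1) ≤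
      (Fintype.card F : ℝ) ^ n - 1 := by
  classical
  have h : n * (irreduciblesOfNorm F n a).ncard * (Fintype.card F - 1) ≤
      Fintype.card F ^ n - 1 := by
    rw [← sum_mul_ncard_irreduciblesOfNorm hn ha]
    refine Nat.mul_le_mul_right _ ?_
    refine le_trans ?_ (Finset.single_le_sum (fun _ _ => Nat.zero_le _) (Nat.one_mem_divisors.2 hn))
    simp [Finset.sum_filter]
  have h := (Nat.cast_le (α := ℝ)).2 h
  rw [Nat.cast_mul, Nat.cast_sub Fintype.card_pos,
    Nat.cast_sub (Nat.one_le_pow _ _ Fintype.card_pos)] at h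
  simpa using h

theorem ncard_pow_eq_le_card_sub_one {F : Type*} [Field F] [Fintype F] (a : F) (d : ℕ) :
    {x : F | x ≠ 0 ∧ x ^ d = a}.ncard ≤ Fintype.card F - 1 := by
  classical
  rw [← Finset.card_univ, ← Finset.card_erase_of_mem (Finset.mem_univ (0 : F)),
    ← Set.ncard_coe_finset]
  exact Set.ncard_le_ncard fun x hx => by simpa using hx.1

theorem ncard_pow_eq_le {F : Type*} [Field F] [Fintype F] (a : F) {d : ℕ} (hd : 0 < d) :
    {x : F | x ≠ 0 ∧ x ^ d = a}.ncard ≤ d := by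
  classical
  refine le_trans ?_ (card_nthRoots d a)
  refine le_trans ?_ (Multiset.toFinset_card_le _)
  rw [← Set.ncard_coe_finset]
  exact Set.ncard_le_ncard fun x hx => by simpa [mem_nthRoots hd] using hx.2

/-- The contribution of the nontrivial divisors is at most `10 * q ^ (n / 2)`. -/
theorem sum_divisors_erase_one_le {q n : ℕ} (hq : 2 ≤ q) (hn : n ≠ 0) {r : ℕ → ℕ}
    (hr : ∀ d ∈ n.divisors, r d ≤ d) (hr' : ∀ d ∈ n.divisors, r d ≤ q - 1) :
    ∑ d ∈ n.divisors.erase 1, (r d : ℝ) * ((q : ℝ) ^ (n / d) - 1) ≤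
      10 * (q : ℝ) ^ ((n : ℝ) / 2) := by
  have hq1 : (1 : ℝ) ≤ q := by exact_mod_cast one_le_two.trans hq
  have hpow : ∀ k : ℕ, 2 * k ≤ n → (q : ℝ) ^ k ≤ (q : ℝ) ^ ((n : ℝ) / 2) := by
    intro k hk
    rw [← Real.rpow_natCast]
    refine Real.rpow_le_rpow_of_exponent_le hq1 ?_
    rw [le_div_iff₀ two_pos]
    exact_mod_cast (mul_comm k 2).trans_le hk
  have hX : (0 : ℝ) ≤ (q : ℝ) ^ ((n : ℝ) / 2) := by positivity
  have hnonneg : ∀ k : ℕ, (0 : ℝ) ≤ (q : ℝ) ^ k - 1 :=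
    fun k => sub_nonneg.2 (one_le_pow₀ hq1)
  have htwo : ∑ d ∈ n.divisors.erase 1 with d = 2, (r d : ℝ) * ((q : ℝ) ^ (n / d) - 1) ≤
      2 * (q : ℝ) ^ ((n : ℝ) / 2) := by
    rw [Finset.sum_filter, Finset.sum_ite_eq']
    split_ifs with h
    · have h2 : (r 2 : ℝ) ≤ 2 := by exact_mod_cast hr 2 (Finset.mem_of_mem_erase h)
      have := hpow (n / 2) (Nat.mul_div_le n 2)
      refine mul_le_mul h2 (by linarith) (hnonneg _) zero_le_two
    · positivity
  have hge : ∀ d ∈ (n.divisors.erase 1).filter (fun d => ¬ d = 2), d ∈ n.divisors ∧ 3 ≤ d := by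
    intro d hd
    simp only [Finset.mem_filter, Finset.mem_erase] at hd
    have := Nat.pos_of_mem_divisors hd.1.2
    exact ⟨hd.1.2, by omega⟩
  have hrest : ∑ d ∈ n.divisors.erase 1 with ¬ d = 2, (r d : ℝ) * ((q : ℝ) ^ (n / d) - 1) ≤
      8 * (q : ℝ) ^ ((n : ℝ) / 2) := by
    rcases lt_or_ge n 6 with h6 | h6
    · have hsub : (n.divisors.erase 1).filter (fun d => ¬ d = 2) ⊆ {n} := by
        intro d hd
        obtain ⟨hd, h3⟩ := hge d hd
        obtain ⟨k, hk⟩ := Nat.dvd_of_mem_divisors hd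
        rw [Finset.mem_singleton]
        have : k < 2 := by by_contra! h; nlinarith
        interval_cases k <;> omega
      rcases Finset.subset_singleton_iff.1 hsub with h | h
      · rw [h, Finset.sum_empty]
        positivity
      · obtain ⟨hd, h3⟩ := hge n (h ▸ Finset.mem_singleton_self n)
        rw [h, Finset.sum_singleton, Nat.div_self (by omega)]
        have h5 : (r n : ℝ) ≤ 5 := by exact_mod_cast (hr n hd).trans (by omega)
        have := hpow 1 (by omega)
        have := mul_le_mul h5 le_rfl (hnonneg 1) (by norm_num)
        linarith
    · let g : ℕ → ℝ := fun k => (q : ℝ) ^ k * ((q : ℝ) - 1)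
      have hg : ∀ k, 0 ≤ g k := fun k => mul_nonneg (by positivity) (by linarith)
      have hinj : Set.InjOn (fun d => n / d)
          ((n.divisors.erase 1).filter (fun d => ¬ d = 2) : Finset ℕ) := by
        intro d hd e he hde
        have hd := Nat.dvd_of_mem_divisors (hge d hd).1
        have he := Nat.dvd_of_mem_divisors (hge e he).1
        have hde : n / d = n / e := hde
        rw [← Nat.div_div_self hd hn, hde, Nat.div_div_self he hn]
      calc ∑ d ∈ n.divisors.erase 1 with ¬ d = 2, (r d : ℝ) * ((q : ℝ) ^ (n / d) - 1)
          ≤ ∑ d ∈ n.divisors.erase 1 with ¬ d = 2, g (n / d) := by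
            refine Finset.sum_le_sum fun d hd => ?_
            have h := (Nat.cast_le (α := ℝ)).2 (hr' d (hge d hd).1)
            rw [Nat.cast_sub (by omega), Nat.cast_one] at h
            rw [mul_comm]
            refine mul_le_mul (by linarith) h (Nat.cast_nonneg _) (by positivity)
        _ = ∑ k ∈ ((n.divisors.erase 1).filter (fun d => ¬ d = 2)).image (fun d => n / d), g k :=
            (Finset.sum_image hinj).symm
        _ ≤ ∑ k ∈ Finset.range (n / 3 + 1), g k := by
            refine Finset.sum_le_sum_of_subset_of_nonneg ?_ fun k _ _ => hg k
            intro k hk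
            obtain ⟨d, hd, rfl⟩ := Finset.mem_image.1 hk
            rw [Finset.mem_range, Nat.lt_succ_iff]
            exact Nat.div_le_div_left (hge d hd).2 (by norm_num)
        _ = (q : ℝ) ^ (n / 3 + 1) - 1 := by
            rw [← Finset.sum_mul, geom_sum_mul]
        _ ≤ 8 * (q : ℝ) ^ ((n : ℝ) / 2) := by
            have := hpow (n / 3 + 1) (by omega)
            linarith
  rw [← Finset.sum_filter_add_sum_filter_not _ (fun d => d = 2)]
  linarith

theorem sub_ten_mul_le_mul_ncard_irreduciblesOfNorm {F : Type*} [Field F] [Fintype F] {n : ℕ}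
    (hn : n ≠ 0) {a : F} (ha : a ≠ 0) :
    (Fintype.card F : ℝ) ^ n - 1 - 10 * (Fintype.card F : ℝ) ^ ((n : ℝ) / 2) ≤
      (n : ℝ) * (irreduciblesOfNorm F n a).ncard * ((Fintype.card F : ℝ) - 1) := by
  have hq : (1 : ℝ) < Fintype.card F := by exact_mod_cast Fintype.one_lt_card
  have hle := sum_divisors_erase_one_le (q := Fintype.card F) Fintype.one_lt_card hn
    (r := fun d => {x : F | x ≠ 0 ∧ x ^ d = a}.ncard)
    (fun d hd => ncard_pow_eq_le a (Nat.pos_of_mem_divisors hd))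
    (fun d _ => ncard_pow_eq_le_card_sub_one a d)
  have hone : {x : F | x ≠ 0 ∧ x ^ 1 = a}.ncard = 1 := by
    rw [Set.ncard_eq_one]
    refine ⟨a, Set.ext fun x => ?_⟩
    simp only [pow_one, Set.mem_ofPred_eq, Set.mem_singleton_iff, and_iff_right_iff_imp]
    rintro rfl
    exact ha
  rw [ncard_irreduciblesOfNorm_eq hn ha, Finset.sum_mul,
    ← Finset.add_sum_erase _ _ (Nat.one_mem_divisors.2 hn), hone]
  have hrest : -∑ d ∈ n.divisors.erase 1, ({x : F | x ≠ 0 ∧ x ^ d = a}.ncard : ℝ) *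
      ((Fintype.card F : ℝ) ^ (n / d) - 1) ≤
      ∑ d ∈ n.divisors.erase 1, (ArithmeticFunction.moebius d : ℝ) *
        ({x : F | x ≠ 0 ∧ x ^ d = a}.ncard : ℝ) *
          (((Fintype.card F : ℝ) ^ (n / d) - 1) / ((Fintype.card F : ℝ) - 1)) *
            ((Fintype.card F : ℝ) - 1) := by
    rw [← Finset.sum_neg_distrib]
    refine Finset.sum_le_sum fun d _ => ?_
    rw [mul_assoc _ (_ / _), div_mul_cancel₀ _ (sub_pos.2 hq).ne', mul_assoc, ← neg_one_mul]
    refine mul_le_mul_of_nonneg_right ?_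
      (mul_nonneg (Nat.cast_nonneg _) (sub_nonneg.2 (one_le_pow₀ hq.le)))
    exact_mod_cast (abs_le.1 (ArithmeticFunction.abs_moebius_le_one (n := d))).1
  have hfirst : (ArithmeticFunction.moebius 1 : ℝ) * ((1 : ℕ) : ℝ) *
      (((Fintype.card F : ℝ) ^ (n / 1) - 1) / ((Fintype.card F : ℝ) - 1)) *
        ((Fintype.card F : ℝ) - 1) = (Fintype.card F : ℝ) ^ n - 1 := by
    rw [mul_assoc, div_mul_cancel₀ _ (sub_pos.2 hq).ne']
    simp
  rw [hfirst]
  linarith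

/-- **Prime polynomial theorem with prescribed constant coefficient.**
The number of monic irreducible polynomials of degree `n` over a finite field `F` with `q`
elements whose constant coefficient is `(-1)^n * a` (for `a ≠ 0`) is given exactly by
`(1/n) ∑_{d ∣ n} μ(d) r_d(a) (q^{n/d} - 1)/(q - 1)`, where `r_d(a)` is the number of `d`-th
roots of `a` in `F^×`; moreover it equals `(q^n - 1 - ε q^{n/2})/(n(q-1))` with `0 ≤ ε ≤ 10`. -/
theorem stmt0 (F : Type) [Field F] [Fintype F] (q n : ℕ) (hq : Fintype.card F = q)
    (hn : 1 ≤ n) (a : F) (ha : a ≠ 0) :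
    (({f : F[X] | f.Monic ∧ Irreducible f ∧ f.natDegree = n ∧
        f.coeff 0 = (-1 : F) ^ n * a}.ncard : ℝ) =
      (1 / n) * ∑ d ∈ n.divisors, (ArithmeticFunction.moebius d : ℝ) *
        ({x : F | x ≠ 0 ∧ x ^ d = a}.ncard : ℝ) * (((q : ℝ) ^ (n / d) - 1) / ((q : ℝ) - 1))) ∧
    ∃ ε : ℝ, 0 ≤ ε ∧ ε ≤ 10 ∧
      ({f : F[X] | f.Monic ∧ Irreducible f ∧ f.natDegree = n ∧
          f.coeff 0 = (-1 : F) ^ n * a}.ncard : ℝ) =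
        ((q : ℝ) ^ n - 1 - ε * (q : ℝ) ^ ((n : ℝ) / 2)) / ((n : ℝ) * ((q : ℝ) - 1)) := by
  have hn0 : n ≠ 0 := Nat.one_le_iff_ne_zero.1 hn
  have hn' : (n : ℝ) ≠ 0 := Nat.cast_ne_zero.2 hn0
  subst hq
  have hq : (1 : ℝ) < Fintype.card F := by exact_mod_cast Fintype.one_lt_card
  have hX : (0 : ℝ) < (Fintype.card F : ℝ) ^ ((n : ℝ) / 2) :=
    Real.rpow_pos_of_pos (one_pos.trans hq) _
  change ((irreduciblesOfNorm F n a).ncard : ℝ) = _ ∧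
    ∃ ε : ℝ, 0 ≤ ε ∧ ε ≤ 10 ∧ ((irreduciblesOfNorm F n a).ncard : ℝ) = _
  have hle := mul_ncard_irreduciblesOfNorm_le hn0 ha
  have hge := sub_ten_mul_le_mul_ncard_irreduciblesOfNorm hn0 ha
  refine ⟨?_, ((Fintype.card F : ℝ) ^ n - 1 - (n : ℝ) * (irreduciblesOfNorm F n a).ncard *
    ((Fintype.card F : ℝ) - 1)) / (Fintype.card F : ℝ) ^ ((n : ℝ) / 2), ?_, ?_, ?_⟩
  · rw [← ncard_irreduciblesOfNorm_eq hn0 ha, one_div, inv_mul_cancel_left₀ hn']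
  · exact div_nonneg (sub_nonneg.2 hle) hX.le
  · rw [div_le_iff₀ hX]
    linarith
  · rw [div_mul_cancel₀ _ hX.ne', eq_div_iff (mul_ne_zero hn' (sub_pos.2 hq).ne')]
    ring
end

section
/- There is an absolute constant C > 0 with the following property. Let F be a finite field with q elements, let n ≥ 1, let a ∈ F^×, let I_1, …, I_r be a partition of the set of monic irreducible polynomials over F of degree ≤ n, and let m_1, …, m_r ≥ 0 be integers such that m_i = 0 whenever I_i is empty. Then the number of squarefree monic polynomials f of degree n over F with constant coefficient a having exactly m_i distinct irreducible factors in I_i for each i is at most C·q^{n−1}·∏_{i=1}^r ( e^{−H(I_i)}·H(I_i)^{m_i}/m_i! )·( m_1/H(I_1) + ⋯ + m_r/H(I_r) ), where terms m_i/H(I_i) with m_i = 0 are interpreted as 0. -/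
open Polynomial

/-- `H(I) = ∑_{g ∈ I} q^{-deg g}`. -/
noncomputable def polyH (q : ℕ) {F : Type} [Field F] (I : Set F[X]) : ℝ :=
  ∑ᶠ g ∈ I, ((q : ℝ) ^ g.natDegree)⁻¹

section Combinatorics

open Finset

lemma pow_succ_add_le_add_pow_succ {x y : ℝ} (hx : 0 ≤ x) (hy : 0 ≤ y) (k : ℕ) :
    x ^ (k + 1) + (k + 1) * y * x ^ k ≤ (x + y) ^ (k + 1) := by
  induction k with
  | zero => simp
  | succ k ih =>
    have h := mul_le_mul_of_nonneg_right ih (add_nonneg hx hy)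
    have h2 : 0 ≤ ((k : ℝ) + 1) * y ^ 2 * x ^ k := by positivity
    rw [pow_succ (x + y)]
    refine le_trans ?_ h
    push_cast
    ring_nf at h2 ⊢
    linarith

/-- The elementary symmetric function of degree `k` is at most `(∑ w) ^ k / k!`. -/
lemma sum_powersetCard_prod_le {α : Type*} {w : α → ℝ} (hw : ∀ x, 0 ≤ w x)
    (s : Finset α) (k : ℕ) :
    ∑ T ∈ powersetCard k s, ∏ x ∈ T, w x ≤ (∑ x ∈ s, w x) ^ k / (k.factorial : ℝ) := by
  classical
  induction s using Finset.induction_on generalizing k with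
  | empty =>
    cases k with
    | zero => simp
    | succ k => rw [powersetCard_eq_empty.2 (by simp)]; simp
  | insert y s hy ih =>
    cases k with
    | zero => simp
    | succ k =>
      have hs : 0 ≤ ∑ x ∈ s, w x := sum_nonneg fun x _ => hw x
      have hprod (T : Finset α) (hT : T ∈ powersetCard k s) :
          ∏ x ∈ insert y T, w x = w y * ∏ x ∈ T, w x :=
        prod_insert fun h => hy ((mem_powersetCard.1 hT).1 h)
      have hdisj : Disjoint (powersetCard (k + 1) s) ((powersetCard k s).image (insert y)) := by
        rw [disjoint_left]
        intro T hT hT'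
        obtain ⟨T', -, rfl⟩ := mem_image.1 hT'
        exact hy ((mem_powersetCard.1 hT).1 (mem_insert_self _ _))
      have hinj : Set.InjOn (insert y) (powersetCard k s : Set (Finset α)) := by
        intro T hT T' hT' h
        have h1 : y ∉ T := fun h => hy ((mem_powersetCard.1 hT).1 h)
        have h2 : y ∉ T' := fun h => hy ((mem_powersetCard.1 hT').1 h)
        rw [← erase_insert h1, ← erase_insert h2, h]
      rw [powersetCard_succ_insert hy, sum_union hdisj, sum_image hinj,
        sum_congr rfl hprod, ← mul_sum, sum_insert hy]
      refine (add_le_add (ih (k + 1)) (mul_le_mul_of_nonneg_left (ih k) (hw y))).trans ?_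
      have hk : (0 : ℝ) < k.factorial := by positivity
      have hk' : ((k + 1).factorial : ℝ) = (k + 1) * k.factorial := by
        push_cast [Nat.factorial_succ]; ring
      have key := pow_succ_add_le_add_pow_succ hs (hw y) k
      rw [hk', add_comm (w y)]
      calc _ = ((∑ x ∈ s, w x) ^ (k + 1) + (k + 1) * w y * (∑ x ∈ s, w x) ^ k) /
            ((k + 1) * k.factorial) := by field_simp
        _ ≤ _ := by gcongr

variable {α ι : Type*} [Fintype ι] [DecidableEq ι]

/-- The subsets of `U` with exactly `m i` elements of colour `i`, for every `i`. -/
def colouredSubsets (U : Finset α) (c : α → ι) (m : ι → ℕ) : Finset (Finset α) :=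
  U.powerset.filter fun S => ∀ i, #{x ∈ S | c x = i} = m i

lemma mem_colouredSubsets {U : Finset α} {c : α → ι} {m : ι → ℕ} {S : Finset α} :
    S ∈ colouredSubsets U c m ↔ S ⊆ U ∧ ∀ i, #{x ∈ S | c x = i} = m i := by
  rw [colouredSubsets, mem_filter, mem_powerset]

lemma sum_colouredSubsets_prod_le {w : α → ℝ} (hw : ∀ x, 0 ≤ w x)
    (U : Finset α) (c : α → ι) (m : ι → ℕ) :
    ∑ S ∈ colouredSubsets U c m, ∏ x ∈ S, w x ≤
      ∏ i, (∑ x ∈ U with c x = i, w x) ^ m i / ((m i).factorial : ℝ) := by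
  classical
  have hle : ∏ i, ∑ T ∈ powersetCard (m i) {x ∈ U | c x = i}, ∏ x ∈ T, w x ≤
      ∏ i, (∑ x ∈ U with c x = i, w x) ^ m i / ((m i).factorial : ℝ) :=
    prod_le_prod (fun i _ => sum_nonneg fun T _ => prod_nonneg fun x _ => hw x)
      fun i _ => sum_powersetCard_prod_le hw _ _
  refine le_trans ?_ hle
  rw [prod_univ_sum]
  have hinj : Set.InjOn (fun (S : Finset α) (i : ι) => ({x ∈ S | c x = i} : Finset α))
      (colouredSubsets U c m) := by
    intro S _ T _ h
    ext x
    have := congrFun h (c x)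
    simpa using congrArg (x ∈ ·) this
  have hprod (S : Finset α) : ∏ x ∈ S, w x = ∏ i, ∏ x ∈ S with c x = i, w x :=
    (prod_fiberwise S c w).symm
  rw [sum_congr rfl fun S _ => hprod S,
    ← sum_image (f := fun p : ι → Finset α => ∏ i, ∏ x ∈ p i, w x) hinj]
  refine sum_le_sum_of_subset_of_nonneg ?_ fun p _ _ =>
    prod_nonneg fun i _ => prod_nonneg fun x _ => hw x
  intro p hp
  obtain ⟨S, hS, rfl⟩ := mem_image.1 hp
  obtain ⟨hSU, hS⟩ := mem_colouredSubsets.1 hS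
  exact Fintype.mem_piFinset.2 fun i => mem_powersetCard.2 ⟨filter_subset_filter _ hSU, hS i⟩

/-- Removing an element of colour `i` from the members of a family of coloured subsets. -/
lemma sum_sum_colour_le_sum_erase [DecidableEq α] {d : α → ℝ} (hd : ∀ x, 0 ≤ d x)
    {U : Finset α} {c : α → ι} {m : ι → ℕ} {A : Finset (Finset α)}
    (hA : A ⊆ colouredSubsets U c m) (K : Finset α → Finset α)
    (hK : ∀ S ∈ A, ∀ x ∈ S, x ∈ K (S.erase x)) (i : ι) :
    ∑ S ∈ A, ∑ x ∈ S with c x = i, d x ≤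
      ∑ T ∈ colouredSubsets U c (Function.update m i (m i - 1)), ∑ x ∈ K T, d x := by
  rw [sum_sigma', sum_sigma']
  have hinj : Set.InjOn (fun p : (_ : Finset α) × α => (⟨p.1.erase p.2, p.2⟩ : (_ : Finset α) × α))
      (A.sigma fun S => {x ∈ S | c x = i}) := by
    rintro ⟨S, x⟩ hS ⟨T, y⟩ hT h
    simp only [coe_sigma, Set.mem_sigma_iff, mem_coe, mem_filter] at hS hT
    simp only [Sigma.mk.injEq, heq_eq_eq] at h ⊢
    obtain ⟨h1, rfl⟩ := h
    exact ⟨by rw [← insert_erase hS.2.1, h1, insert_erase hT.2.1], rfl⟩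
  rw [← sum_image (f := fun p : (_ : Finset α) × α => d p.2) hinj]
  refine sum_le_sum_of_subset_of_nonneg ?_ fun p _ _ => hd _
  intro p hp
  obtain ⟨⟨S, x⟩, hS, rfl⟩ := mem_image.1 hp
  simp only [mem_sigma, mem_filter] at hS
  obtain ⟨hSA, hxS, rfl⟩ := hS
  obtain ⟨hSU, hS⟩ := mem_colouredSubsets.1 (hA hSA)
  refine mem_sigma.2 ⟨mem_colouredSubsets.2 ⟨?_, fun j => ?_⟩, hK S hSA x hxS⟩ <;> dsimp only
  · exact (erase_subset _ _).trans hSU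
  · rw [filter_erase]
    by_cases hj : j = c x
    · subst hj
      rw [card_erase_of_mem (by simp [hxS]), hS, Function.update_self]
    · rw [erase_eq_of_notMem (by simp [Ne.symm hj]), hS, Function.update_of_ne hj]

end Combinatorics

section PrimeCounting

variable {F : Type*} [Field F]

lemma pairwise_isCoprime_of_monic_irreducible {s : Finset F[X]}
    (hs : ∀ P ∈ s, P.Monic ∧ Irreducible P) :
    (s : Set F[X]).Pairwise (Function.onFun IsCoprime fun P => P) := by
  intro P hP Q hQ hPQ
  refine ((hs P hP).2.coprime_iff_not_dvd).2 fun h => hPQ ?_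
  exact eq_of_monic_of_associated (hs P hP).1 (hs Q hQ).1
    (((hs P hP).2.dvd_irreducible_iff_associated (hs Q hQ).2).1 h)

lemma sum_natDegree_le_of_dvd {s : Finset F[X]} {f : F[X]} (hf : f ≠ 0)
    (hs : ∀ P ∈ s, P.Monic ∧ Irreducible P) (hd : ∀ P ∈ s, P ∣ f) :
    ∑ P ∈ s, P.natDegree ≤ f.natDegree := by
  rw [← natDegree_prod_of_monic s (fun P => P) fun P hP => (hs P hP).1]
  exact natDegree_le_of_dvd (Finset.prod_dvd_of_coprime
    (pairwise_isCoprime_of_monic_irreducible hs) hd) hf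

variable [Fintype F]

lemma sum_natDegree_irreducible_le {s : Finset F[X]} {d : ℕ} (hd : d ≠ 0)
    (hs : ∀ P ∈ s, P.Monic ∧ Irreducible P) (hsd : ∀ P ∈ s, P.natDegree = d) :
    ∑ P ∈ s, P.natDegree ≤ Fintype.card F ^ d := by
  have hq : 1 < Fintype.card F := Fintype.one_lt_card
  rw [← FiniteField.X_pow_card_pow_sub_X_natDegree_eq F hd hq]
  refine sum_natDegree_le_of_dvd (FiniteField.X_pow_card_pow_sub_X_ne_zero F hd hq) hs
    fun P hP => ?_
  rw [← Nat.card_eq_fintype_card,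
    ← (hs P hP).2.natDegree_dvd_iff_dvd_X_pow_card_pow_sub_X, hsd P hP]

/-- The norm of a root of `P` is, up to sign, the constant coefficient of `P`. -/
lemma irreducible_dvd_X_pow_geom_sum_sub_C {P : F[X]} (hm : P.Monic) (hP : Irreducible P) :
    P ∣ X ^ (∑ i ∈ Finset.range P.natDegree, Fintype.card F ^ i) -
      C ((-1) ^ P.natDegree * P.coeff 0) := by
  have : Fact (Irreducible P) := ⟨hP⟩
  let pb := AdjoinRoot.powerBasis hP.ne_zero
  have : Module.Finite F (AdjoinRoot P) := pb.finite
  have : Finite (AdjoinRoot P) := Module.finite_of_finite F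
  have hmin : minpoly F pb.gen = P := by
    rw [AdjoinRoot.powerBasis_gen, AdjoinRoot.minpoly_root hP.ne_zero, hm.leadingCoeff]
    simp
  have hfr : Module.finrank F (AdjoinRoot P) = P.natDegree := by
    rw [pb.finrank, AdjoinRoot.powerBasis_dim]
  have h := FiniteField.algebraMap_norm_eq_pow_sum F (AdjoinRoot P) pb.gen
  rw [Algebra.PowerBasis.norm_gen_eq_coeff_zero_minpoly, hmin, hfr,
    AdjoinRoot.powerBasis_dim, Nat.card_eq_fintype_card, AdjoinRoot.powerBasis_gen] at h
  rw [← AdjoinRoot.mk_eq_zero, map_sub, map_pow, AdjoinRoot.mk_X, ← h, AdjoinRoot.mk_C,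
    AdjoinRoot.algebraMap_eq, sub_self]

lemma sum_natDegree_irreducible_coeff_zero_le {s : Finset F[X]} {d : ℕ} {b : F}
    (hd : d ≠ 0) (hs : ∀ P ∈ s, P.Monic ∧ Irreducible P) (hsd : ∀ P ∈ s, P.natDegree = d)
    (hsb : ∀ P ∈ s, P.coeff 0 = b) :
    ∑ P ∈ s, P.natDegree ≤ 2 * Fintype.card F ^ (d - 1) := by
  obtain ⟨e, rfl⟩ := Nat.exists_eq_succ_of_ne_zero hd
  have hq : 2 ≤ Fintype.card F := Fintype.one_lt_card
  have hM : ∑ i ∈ Finset.range (e + 1), Fintype.card F ^ i ≠ 0 := by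
    rw [Finset.sum_range_succ]; positivity
  have h := sum_natDegree_le_of_dvd (X_pow_sub_C_ne_zero (Nat.pos_of_ne_zero hM)
    ((-1) ^ (e + 1) * b)) hs fun P hP => by
      have := irreducible_dvd_X_pow_geom_sum_sub_C (hs P hP).1 (hs P hP).2
      rwa [hsd P hP, hsb P hP] at this
  rw [natDegree_X_pow_sub_C, Finset.sum_range_succ] at h
  have hlt : ∑ i ∈ Finset.range e, Fintype.card F ^ i < Fintype.card F ^ e :=
    Nat.geomSum_lt hq fun k hk => Finset.mem_range.1 hk
  simp only [Nat.succ_eq_add_one, add_tsub_cancel_right]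
  omega

lemma finite_setOf_natDegree_le (n : ℕ) : {f : F[X] | f.natDegree ≤ n}.Finite := by
  refine Set.Finite.of_injOn (f := fun f (i : Fin (n + 1)) => f.coeff i)
    (t := Set.univ) (fun _ _ => Set.mem_univ _) ?_ Set.finite_univ
  intro f hf g hg h
  ext k
  by_cases hk : k ≤ n
  · exact congrFun h ⟨k, by omega⟩
  · rw [coeff_eq_zero_of_natDegree_lt (lt_of_le_of_lt hf (by omega)),
      coeff_eq_zero_of_natDegree_lt (lt_of_le_of_lt hg (by omega))]

/-- A weak form of Mertens' theorem for polynomials over a finite field. -/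
lemma sum_inv_card_pow_natDegree_le {U : Finset F[X]} {n : ℕ}
    (hU : ∀ P ∈ U, P.Monic ∧ Irreducible P ∧ P.natDegree ≤ n) :
    ∑ P ∈ U, ((Fintype.card F : ℝ) ^ P.natDegree)⁻¹ ≤ 1 + Real.log n := by
  have hq : (0 : ℝ) < Fintype.card F := by exact_mod_cast Fintype.card_pos
  have hmap : ∀ P ∈ U, P.natDegree ∈ Finset.Icc 1 n := fun P hP =>
    Finset.mem_Icc.2 ⟨(hU P hP).2.1.natDegree_pos, (hU P hP).2.2⟩
  rw [← Finset.sum_fiberwise_of_maps_to hmap]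
  have h := harmonic_le_one_add_log n
  rw [harmonic_eq_sum_Icc] at h
  push_cast at h
  refine le_trans (Finset.sum_le_sum fun d hd => ?_) h
  have hd0 : (0 : ℝ) < d := by exact_mod_cast (Finset.mem_Icc.1 hd).1
  have hc := sum_natDegree_irreducible_le (s := {P ∈ U | P.natDegree = d})
    (Nat.pos_iff_ne_zero.1 (Finset.mem_Icc.1 hd).1) (fun P hP => ⟨(hU P (Finset.mem_filter.1 hP).1).1,
      (hU P (Finset.mem_filter.1 hP).1).2.1⟩) fun P hP => (Finset.mem_filter.1 hP).2
  rw [Finset.sum_congr rfl fun P hP => (Finset.mem_filter.1 hP).2] at hc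
  rw [Finset.sum_congr rfl fun P hP => by rw [(Finset.mem_filter.1 hP).2]]
  rw [Finset.sum_const, smul_eq_mul] at hc
  have hc' : ((Finset.card {P ∈ U | P.natDegree = d} : ℕ) : ℝ) * d ≤ (Fintype.card F : ℝ) ^ d := by
    exact_mod_cast hc
  rw [Finset.sum_const, nsmul_eq_mul, ← div_eq_mul_inv, div_le_iff₀ (by positivity),
    inv_mul_eq_div, le_div_iff₀ hd0]
  exact hc'

end PrimeCounting

lemma prod_irreducible_factors_eq {F : Type*} [Field F] {f : F[X]} {s : Finset F[X]}
    (hf : f.Monic) (hsq : Squarefree f)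
    (hs : ∀ P, P ∈ s ↔ P.Monic ∧ Irreducible P ∧ P ∣ f) : ∏ P ∈ s, P = f := by
  have hs' : ∀ P ∈ s, P.Monic ∧ Irreducible P := fun P hP =>
    ⟨((hs P).1 hP).1, ((hs P).1 hP).2.1⟩
  obtain ⟨h, hh⟩ : ∏ P ∈ s, P ∣ f := Finset.prod_dvd_of_coprime
    (pairwise_isCoprime_of_monic_irreducible hs') fun P hP => ((hs P).1 hP).2.2
  have hm : (∏ P ∈ s, P).Monic := monic_prod_of_monic _ _ fun P hP => (hs' P hP).1
  have hhm : h.Monic := hm.of_mul_monic_left (hh ▸ hf)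
  have hu : IsUnit h := by
    by_contra hu
    obtain ⟨P, hPm, hPi, hPh⟩ := exists_monic_irreducible_factor h hu
    have hPf : P ∣ f := hPh.trans (hh ▸ dvd_mul_left _ _)
    have hPs : P ∣ ∏ P ∈ s, P := Finset.dvd_prod_of_mem _ ((hs P).2 ⟨hPm, hPi, hPf⟩)
    exact hPi.not_isUnit (hsq P (hh ▸ mul_dvd_mul hPs hPh))
  rw [hh, hhm.eq_one_of_isUnit hu, mul_one]

section Counting

open Finset

variable {F : Type*} [Field F] [Fintype F]

/-- Among the monic irreducible `P` for which `P * t` has degree `n` and constant coefficient `a`,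
the total degree is at most `2 q ^ (n - 1) / q ^ deg t`. -/
lemma sum_natDegree_complement_le [DecidableEq F] {U : Finset F[X]} (hU : ∀ P ∈ U, P.Monic ∧ Irreducible P)
    {n D : ℕ} {a t : F} (ha : a ≠ 0) :
    (∑ P ∈ U with P.natDegree + D = n ∧ P.coeff 0 * t = a, (P.natDegree : ℝ)) ≤
      2 * (Fintype.card F : ℝ) ^ (n - 1) * ((Fintype.card F : ℝ) ^ D)⁻¹ := by
  have hq : (0 : ℝ) < Fintype.card F := by exact_mod_cast Fintype.card_pos
  rcases Finset.eq_empty_or_nonempty {P ∈ U | P.natDegree + D = n ∧ P.coeff 0 * t = a}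
    with he | ⟨P₀, hP₀⟩
  · rw [he, sum_empty]; positivity
  obtain ⟨hP₀U, hP₀d, hP₀t⟩ := mem_filter.1 hP₀
  have hpos := (hU P₀ hP₀U).2.natDegree_pos
  have ht : t ≠ 0 := by
    rintro rfl
    exact ha (by rw [← hP₀t, mul_zero])
  have h := sum_natDegree_irreducible_coeff_zero_le
    (s := {P ∈ U | P.natDegree + D = n ∧ P.coeff 0 * t = a}) (d := n - D) (b := a / t)
    (by omega) (fun P hP => hU P (mem_filter.1 hP).1)
    (fun P hP => by have := (mem_filter.1 hP).2.1; omega)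
    (fun P hP => by rw [eq_div_iff ht]; exact (mem_filter.1 hP).2.2)
  have h' : (∑ P ∈ U with P.natDegree + D = n ∧ P.coeff 0 * t = a, (P.natDegree : ℝ)) ≤
      2 * (Fintype.card F : ℝ) ^ (n - D - 1) := by exact_mod_cast h
  refine h'.trans (le_of_eq ?_)
  rw [show n - 1 = n - D - 1 + D by omega, pow_add]
  field_simp

variable {ι : Type*} [Fintype ι] [DecidableEq ι]

lemma natCast_mul_card_le [DecidableEq F] {U : Finset F[X]}
    (hU : ∀ P ∈ U, P.Monic ∧ Irreducible P)
    (c : F[X] → ι) (m : ι → ℕ) (n : ℕ) {a : F} (ha : a ≠ 0) (H : ι → ℝ)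
    (hH : ∀ i, H i = ∑ P ∈ U with c P = i, ((Fintype.card F : ℝ) ^ P.natDegree)⁻¹)
    (hm : ∀ i, m i ≠ 0 → 0 < H i) :
    (n : ℝ) * #{S ∈ colouredSubsets U c m | ∑ P ∈ S, P.natDegree = n ∧
        (∏ P ∈ S, P).coeff 0 = a} ≤
      2 * (Fintype.card F : ℝ) ^ (n - 1) * (∏ i, H i ^ m i / ((m i).factorial : ℝ)) *
        ∑ i, (m i : ℝ) / H i := by
  set q : ℝ := (Fintype.card F : ℝ) with hqdef
  have hq : 0 < q := by rw [hqdef]; exact_mod_cast Fintype.card_pos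
  set A := {S ∈ colouredSubsets U c m | ∑ P ∈ S, P.natDegree = n ∧
        (∏ P ∈ S, P).coeff 0 = a} with hA
  let K (T : Finset F[X]) : Finset F[X] :=
    {P ∈ U | P.natDegree + ∑ Q ∈ T, Q.natDegree = n ∧ P.coeff 0 * (∏ Q ∈ T, Q).coeff 0 = a}
  have hK : ∀ S ∈ A, ∀ P ∈ S, P ∈ K (S.erase P) := by
    intro S hS P hP
    obtain ⟨hSc, hSn, hSa⟩ := mem_filter.1 hS
    refine mem_filter.2 ⟨(mem_colouredSubsets.1 hSc).1 hP, ?_, ?_⟩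
    · rw [← hSn, add_sum_erase S (fun Q => Q.natDegree) hP]
    · rw [← mul_coeff_zero, mul_prod_erase S (fun Q => Q) hP, hSa]
  have hsum : (n : ℝ) * #A = ∑ i, ∑ S ∈ A, ∑ P ∈ S with c P = i, (P.natDegree : ℝ) := by
    rw [sum_comm, mul_comm, ← nsmul_eq_mul, ← sum_const]
    refine sum_congr rfl fun S hS => ?_
    rw [sum_fiberwise, ← (mem_filter.1 hS).2.1]
    push_cast
    rfl
  rw [hsum, mul_sum]
  refine sum_le_sum fun i _ => ?_
  rcases Nat.eq_zero_or_pos (m i) with h0 | hpos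
  · rw [h0, Nat.cast_zero, zero_div, mul_zero]
    refine (sum_eq_zero fun S hS => ?_).le
    have := (mem_colouredSubsets.1 (mem_filter.1 hS).1).2 i
    rw [h0, card_eq_zero] at this
    rw [this, sum_empty]
  have hHi := hm i hpos.ne'
  refine (sum_sum_colour_le_sum_erase (fun P => Nat.cast_nonneg _) (filter_subset _ _) K hK
    i).trans ?_
  have hT (T : Finset F[X]) : ∑ P ∈ K T, (P.natDegree : ℝ) ≤
      2 * q ^ (n - 1) * ∏ P ∈ T, (q ^ P.natDegree)⁻¹ := by
    rw [prod_inv_distrib, prod_pow_eq_pow_sum]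
    exact sum_natDegree_complement_le hU ha
  refine (sum_le_sum fun T _ => hT T).trans ?_
  rw [← mul_sum, mul_assoc _ (∏ i, _)]
  have hq2 : 0 ≤ 2 * q ^ (n - 1) := by positivity
  refine mul_le_mul_of_nonneg_left ?_ hq2
  refine (sum_colouredSubsets_prod_le (w := fun P => (q ^ P.natDegree)⁻¹)
    (fun P => by positivity) U c _).trans (le_of_eq ?_)
  simp_rw [← hH]
  rw [← mul_prod_erase univ (fun j => H j ^ m j / ((m j).factorial : ℝ)) (mem_univ i),
    ← mul_prod_erase univ _ (mem_univ i), Function.update_self, mul_right_comm]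
  congr 1
  · obtain ⟨k, hk⟩ := Nat.exists_eq_succ_of_ne_zero hpos.ne'
    rw [hk, Nat.succ_eq_add_one, Nat.add_sub_cancel, Nat.factorial_succ, pow_succ]
    push_cast
    field_simp
  · refine prod_congr rfl fun j hj => ?_
    rw [Function.update_of_ne (ne_of_mem_erase hj)]

end Counting

/-- **Poisson-type tail bound, unrestricted case.**
For any partition `I_1, …, I_r` of the monic irreducible polynomials of degree `≤ n` over a
finite field with `q` elements, and any `m_1, …, m_r ≥ 0` (with `m_i = 0` when `I_i = ∅`), the
number of squarefree monic `f` of degree `n` with constant coefficient `a ≠ 0` having exactly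
`m_i` distinct irreducible factors in `I_i` for each `i` is
`≤ C qⁿ⁻¹ ∏_i (e^{-H(I_i)} H(I_i)^{m_i}/m_i!) ⬝ (∑_i m_i/H(I_i))`. -/
theorem stmt3 : ∃ C : ℝ, 0 < C ∧
    ∀ (F : Type) [Field F] [Fintype F], ∀ (q n r : ℕ) (a : F),
      Fintype.card F = q → 1 ≤ n → a ≠ 0 →
      ∀ I : Fin r → Set F[X],
        (∀ i j, i ≠ j → Disjoint (I i) (I j)) →
        (⋃ i, I i) = {g : F[X] | g.Monic ∧ Irreducible g ∧ g.natDegree ≤ n} →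
      ∀ m : Fin r → ℕ, (∀ i, I i = ∅ → m i = 0) →
        ({f : F[X] | f.Monic ∧ Squarefree f ∧ f.natDegree = n ∧ f.coeff 0 = a ∧
            ∀ i, {g ∈ I i | g ∣ f}.ncard = m i}.ncard : ℝ) ≤
          C * (q : ℝ) ^ (n - 1) *
            (∏ i : Fin r, Real.exp (-(polyH q (I i))) * (polyH q (I i)) ^ (m i) /
              (Nat.factorial (m i) : ℝ)) *
            (∑ i : Fin r, (m i : ℝ) / polyH q (I i)) := by
  classical
  refine ⟨2 * Real.exp 1, by positivity, ?_⟩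
  intro F _ _ q n r a hq hn ha I hdisj hI m hm
  subst hq
  have hfin : {g : F[X] | g.Monic ∧ Irreducible g ∧ g.natDegree ≤ n}.Finite :=
    (finite_setOf_natDegree_le n).subset fun g hg => hg.2.2
  set U : Finset F[X] := hfin.toFinset with hUdef
  have hU (P : F[X]) : P ∈ U ↔ P.Monic ∧ Irreducible P ∧ P.natDegree ≤ n := by simp [hUdef]
  have hIU (i : Fin r) (P : F[X]) (hP : P ∈ I i) : P ∈ U := by
    rw [hU]
    exact hI.subset (Set.mem_iUnion.2 ⟨i, hP⟩)
  have hUI : ∀ P ∈ U, ∃ i, P ∈ I i := fun P hP =>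
    Set.mem_iUnion.1 (hI.superset ((hU P).1 hP))
  have hXU : (X : F[X]) ∈ U := (hU X).2 ⟨monic_X, irreducible_X, by rwa [natDegree_X]⟩
  have : Nonempty (Fin r) := ⟨(hUI X hXU).choose⟩
  choose! c hc using hUI
  have hcI (i : Fin r) (P : F[X]) : P ∈ I i ↔ P ∈ U ∧ c P = i := by
    refine ⟨fun h => ⟨hIU i P h, ?_⟩, fun h => h.2 ▸ hc P h.1⟩
    by_contra hne
    exact Set.disjoint_left.1 (hdisj _ _ hne) (hc P (hIU i P h)) h
  set H : Fin r → ℝ := fun i => polyH (Fintype.card F) (I i) with hHdef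
  have hH (i : Fin r) :
      H i = ∑ P ∈ U with c P = i, ((Fintype.card F : ℝ) ^ P.natDegree)⁻¹ := by
    have : I i = ((U.filter fun P => c P = i : Finset F[X]) : Set F[X]) := by
      ext P
      simp [hcI]
    simp only [hHdef, polyH]
    rw [this, finsum_mem_coe_finset]
  have hq : (0 : ℝ) < Fintype.card F := by exact_mod_cast Fintype.card_pos
  have hH0 (i : Fin r) : 0 ≤ H i := by
    rw [hH]
    positivity
  have hmH (i : Fin r) (hi : m i ≠ 0) : 0 < H i := by
    obtain ⟨P, hP⟩ := Set.nonempty_iff_ne_empty.2 fun h => hi (hm i h)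
    rw [hH]
    exact Finset.sum_pos (fun P _ => by positivity)
      ⟨P, Finset.mem_filter.2 ((hcI i P).1 hP)⟩
  have hcount := natCast_mul_card_le (fun P hP => ⟨((hU P).1 hP).1, ((hU P).1 hP).2.1⟩)
    c m n ha H hH hmH
  set A := {S ∈ colouredSubsets U c m | ∑ P ∈ S, P.natDegree = n ∧
    (∏ P ∈ S, P).coeff 0 = a} with hA
  have hcard : {f : F[X] | f.Monic ∧ Squarefree f ∧ f.natDegree = n ∧ f.coeff 0 = a ∧
      ∀ i, {g ∈ I i | g ∣ f}.ncard = m i}.ncard ≤ A.card := by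
    refine le_trans ?_ (Finset.card_image_le (s := A) (f := fun S => ∏ P ∈ S, P))
    rw [← Set.ncard_coe_finset]
    refine Set.ncard_le_ncard ?_ (Finset.finite_toSet _)
    rintro f ⟨hf, hsq, hfn, hfa, hfm⟩
    have hprod : ∏ P ∈ U with P ∣ f, P = f := by
      refine prod_irreducible_factors_eq hf hsq fun P => ?_
      rw [Finset.mem_filter, hU]
      exact ⟨fun h => ⟨h.1.1, h.1.2.1, h.2⟩, fun h => ⟨⟨h.1, h.2.1,
        hfn ▸ natDegree_le_of_dvd h.2.2 hf.ne_zero⟩, h.2.2⟩⟩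
    refine Finset.mem_coe.2 (Finset.mem_image.2 ⟨{P ∈ U | P ∣ f}, ?_, hprod⟩)
    refine Finset.mem_filter.2 ⟨mem_colouredSubsets.2 ⟨?_, fun i => ?_⟩, ?_, ?_⟩
    · exact Finset.filter_subset _ _
    · rw [← hfm i, ← Set.ncard_coe_finset]
      congr 1
      ext P
      simp only [Finset.coe_filter, Finset.mem_filter, Set.mem_ofPred_eq, hcI]
      tauto
    · rw [← natDegree_prod_of_monic _ (fun P => P) fun P hP =>
        ((hU P).1 (Finset.mem_filter.1 hP).1).1, hprod, hfn]
    · rw [hprod, hfa]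
  have hn0 : (0 : ℝ) < n := by exact_mod_cast hn
  have hHsum : ∑ i, H i ≤ 1 + Real.log n := by
    simp_rw [hH]
    rw [Finset.sum_fiberwise]
    exact sum_inv_card_pow_natDegree_le fun P hP => (hU P).1 hP
  have hexp : 1 ≤ Real.exp 1 * n * ∏ i, Real.exp (-H i) := by
    calc 1 ≤ Real.exp (1 + Real.log n + -∑ i, H i) := Real.one_le_exp (by linarith)
      _ = _ := by rw [Real.exp_add, Real.exp_add, Real.exp_log hn0, ← Finset.sum_neg_distrib,
        Real.exp_sum]
  have hsplit : ∏ i, Real.exp (-H i) * H i ^ m i / (Nat.factorial (m i) : ℝ) =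
      (∏ i, Real.exp (-H i)) * ∏ i, H i ^ m i / (Nat.factorial (m i) : ℝ) := by
    rw [← Finset.prod_mul_distrib]
    exact Finset.prod_congr rfl fun i _ => by rw [mul_div_assoc]
  change _ ≤ 2 * Real.exp 1 * (Fintype.card F : ℝ) ^ (n - 1) *
    (∏ i, Real.exp (-H i) * H i ^ m i / (Nat.factorial (m i) : ℝ)) * ∑ i, (m i : ℝ) / H i
  rw [hsplit]
  have hprod0 : 0 ≤ ∏ i, H i ^ m i / ((m i).factorial : ℝ) :=
    Finset.prod_nonneg fun i _ => div_nonneg (pow_nonneg (hH0 i) _) (Nat.cast_nonneg _)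
  have hsum0 : 0 ≤ ∑ i, (m i : ℝ) / H i :=
    Finset.sum_nonneg fun i _ => div_nonneg (Nat.cast_nonneg _) (hH0 i)
  refine le_of_mul_le_mul_left ?_ hn0
  calc _ ≤ (n : ℝ) * A.card := by gcongr
    _ ≤ _ := hcount
    _ ≤ _ := le_mul_of_one_le_right (by positivity) hexp
    _ = _ := by ring
end
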